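/- (Proposition 1) For any f : ℤ≥0 → ℝ, any z ∈ ℝ, and any 1 ≤ p ≤ m: ∑_{i=1}^n (f(c_i + m) − f(c_i)) · ( ∑_{J ⊆ T_i, |J| = p−1} ∏_{a ∈ J} (z + f(a)) ) = ∑_{I ⊆ S^(m), |I| = p} ∏_{a ∈ I} (z + f(a)) − ∑_{I ⊆ I_m, |I| = p} ∏_{a ∈ I} (z + f(a)). -/

import Mathlib

open Finset

/-- `SetSi c i` is the numerical semigroup `S_i := ℕ \ {c 1, …, c i}` obtained by
removing the first `i` gaps `c 1 < c 2 < … < c i` from `ℕ`. -/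
def SetSi (c : ℕ → ℕ) (i : ℕ) : Set ℕ := {s | ∀ j ∈ Finset.Icc 1 i, s ≠ c j}

/-- `A` is the Apéry set of `T ⊆ ℕ` with respect to `m`: the elements `s ∈ T` with
`s - m ∉ T`, i.e. such that no `t ∈ T` satisfies `t + m = s`. -/
def IsApery (T : Set ℕ) (m : ℕ) (A : Finset ℕ) : Prop :=
  ∀ s, s ∈ A ↔ s ∈ T ∧ ∀ t ∈ T, t + m ≠ s

lemma esymm_insert_aux (g : ℕ → ℝ) (T : Finset ℕ) (x : ℕ) (hx : x ∉ T) (q : ℕ) :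
    ∑ I ∈ (insert x T).powersetCard (q + 1), ∏ a ∈ I, g a
      = ∑ I ∈ T.powersetCard (q + 1), ∏ a ∈ I, g a
        + g x * ∑ I ∈ T.powersetCard q, ∏ a ∈ I, g a := by
  have hn : ∀ r, ∀ I ∈ T.powersetCard r, x ∉ I := fun r I hI h =>
    hx ((Finset.mem_powersetCard.1 hI).1 h)
  rw [Finset.powersetCard_succ_insert hx, Finset.sum_union, Finset.sum_image, Finset.mul_sum]
  · congr 1
    refine Finset.sum_congr rfl fun I hI => ?_
    rw [Finset.prod_insert (hn _ I hI)]
  · intro I hI J hJ h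
    have h2 : insert x I = insert x J := h
    rw [← Finset.erase_insert (hn _ I hI), h2, Finset.erase_insert (hn _ J hJ)]
  · rw [Finset.disjoint_left]
    intro I hI hI2
    obtain ⟨J, _, rfl⟩ := Finset.mem_image.1 hI2
    exact hn _ _ hI (Finset.mem_insert_self x J)

lemma mem_SetSi_succ_aux (c : ℕ → ℕ) (k s : ℕ) :
    s ∈ SetSi c (k + 1) ↔ s ∈ SetSi c k ∧ s ≠ c (k + 1) := by
  simp only [SetSi, Set.mem_ofPred_eq, Finset.mem_Icc]
  constructor
  · intro h
    exact ⟨fun j hj => h j ⟨hj.1, by omega⟩, h _ ⟨by omega, le_rfl⟩⟩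
  · rintro ⟨h1, h2⟩ j hj
    rcases Nat.lt_or_ge k j with h | h
    · obtain rfl : j = k + 1 := by omega
      exact h2
    · exact h1 j ⟨hj.1, h⟩

/-- **Proposition 1.**  With `S = S_n ⊂ … ⊂ S_0 = ℕ` the canonical path, `Ap i = S_i^(m)`
and `T_i = S_i^(m) \ {c_i + m}`, for any `f : ℕ → ℝ`, `z ∈ ℝ` and `1 ≤ p ≤ m`:
`∑_{i=1}^n (f(c_i+m) − f(c_i)) ∑_{J ⊆ T_i, |J|=p-1} ∏_{a ∈ J} (z + f a)
 = ∑_{I ⊆ S^(m), |I|=p} ∏_{a ∈ I} (z + f a) − ∑_{I ⊆ I_m, |I|=p} ∏_{a ∈ I} (z + f a)`. -/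
theorem prop1_generalized_gassert_shor
    (n : ℕ) (hn : 0 < n)
    (c : ℕ → ℕ) (hc : StrictMonoOn c (Set.Icc 1 n))
    (hzero : (0 : ℕ) ∈ SetSi c n)
    (hadd : ∀ a ∈ SetSi c n, ∀ b ∈ SetSi c n, a + b ∈ SetSi c n)
    (m : ℕ) (hm0 : m ≠ 0) (hm : m ∈ SetSi c n)
    (Ap : ℕ → Finset ℕ) (hAp : ∀ i ≤ n, IsApery (SetSi c i) m (Ap i))
    (f : ℕ → ℝ) (z : ℝ)
    (p : ℕ) (hp : 1 ≤ p) (hpm : p ≤ m) :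
    ∑ i ∈ Finset.Icc 1 n,
        (f (c i + m) - f (c i)) *
          ∑ J ∈ ((Ap i).erase (c i + m)).powersetCard (p - 1),
            ∏ a ∈ J, (z + f a)
      = ∑ I ∈ (Ap n).powersetCard p, ∏ a ∈ I, (z + f a)
        - ∑ I ∈ (Finset.range m).powersetCard p, ∏ a ∈ I, (z + f a) := by
  obtain ⟨q, rfl⟩ : ∃ q, p = q + 1 := ⟨p - 1, by omega⟩
  have h0 : Ap 0 = Finset.range m := by
    ext s
    rw [hAp 0 (Nat.zero_le _) s, Finset.mem_range]
    simp only [SetSi, Set.mem_ofPred_eq, Finset.mem_Icc]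
    constructor
    · rintro ⟨_, h⟩
      by_contra hs
      exact h (s - m) (fun j hj => by omega) (by omega)
    · intro hs
      exact ⟨fun j hj => by omega, fun t _ => by omega⟩
  have key : ∀ k ≤ n, ∑ i ∈ Finset.Icc 1 k,
        (f (c i + m) - f (c i)) *
          ∑ J ∈ ((Ap i).erase (c i + m)).powersetCard q,
            ∏ a ∈ J, (z + f a)
      = ∑ I ∈ (Ap k).powersetCard (q + 1), ∏ a ∈ I, (z + f a)
        - ∑ I ∈ (Finset.range m).powersetCard (q + 1), ∏ a ∈ I, (z + f a) := by
    intro k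
    induction k with
    | zero => intro _; simp [h0]
    | succ k ih =>
      intro hk
      rw [Finset.sum_Icc_succ_top (by omega), ih (by omega)]
      have A1 := hAp (k + 1) hk
      have A0 := hAp k (by omega)
      have hS := mem_SetSi_succ_aux c k
      have hck : c (k + 1) ∈ SetSi c k := by
        intro j hj
        rw [Finset.mem_Icc] at hj
        exact (hc ⟨hj.1, by omega⟩ ⟨by omega, hk⟩ (by omega)).ne'
      have hckm : c (k + 1) + m ∈ SetSi c (k + 1) := by
        rw [hS]
        refine ⟨fun j hj => ?_, by omega⟩
        rw [Finset.mem_Icc] at hj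
        have := hc (a := j) (b := k + 1) ⟨hj.1, by omega⟩ ⟨by omega, hk⟩ (by omega)
        omega
      have hnt : ∀ t ∈ SetSi c k, t + m ≠ c (k + 1) := by
        intro t ht h
        have htn : t ∈ SetSi c n := by
          intro j hj
          rw [Finset.mem_Icc] at hj
          rcases Nat.lt_or_ge k j with h' | h'
          · have := hc.monotoneOn (a := k + 1) (b := j) ⟨by omega, hk⟩ ⟨hj.1, hj.2⟩ (by omega)
            omega
          · exact ht j (Finset.mem_Icc.2 ⟨hj.1, h'⟩)
        exact hadd t htn m hm (k + 1) (Finset.mem_Icc.2 ⟨by omega, hk⟩) h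
      have m1 : c (k + 1) + m ∈ Ap (k + 1) := by
        rw [A1]
        refine ⟨hckm, fun t ht h => ?_⟩
        exact ((hS t).1 ht).2 (by omega)
      have m0 : c (k + 1) ∉ (Ap (k + 1)).erase (c (k + 1) + m) := by
        intro h
        have := ((A1 _).1 (Finset.mem_of_mem_erase h)).1
        exact ((hS _).1 this).2 rfl
      have e0 : Ap k = insert (c (k + 1)) ((Ap (k + 1)).erase (c (k + 1) + m)) := by
        ext s
        rw [Finset.mem_insert, Finset.mem_erase, A1, A0, hS]
        constructor
        · rintro ⟨h1, h2⟩
          by_cases hs : s = c (k + 1)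
          · exact Or.inl hs
          · exact Or.inr ⟨fun h => h2 _ hck h.symm, ⟨h1, hs⟩, fun t ht => h2 t ((hS t).1 ht).1⟩
        · rintro (rfl | ⟨h1, ⟨h2, h3⟩, h4⟩)
          · exact ⟨hck, hnt⟩
          · refine ⟨h2, fun t ht h => ?_⟩
            by_cases htc : t = c (k + 1)
            · exact h1 (by rw [← h, htc])
            · exact h4 t ((hS t).2 ⟨ht, htc⟩) h
      have E0 := esymm_insert_aux (fun a => z + f a) _ _ m0 q
      have E1 := esymm_insert_aux (fun a => z + f a) _ _
        (Finset.notMem_erase (c (k + 1) + m) (Ap (k + 1))) q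
      rw [← e0] at E0
      rw [Finset.insert_erase m1] at E1
      rw [E0, E1]
      ring
  exact key n le_rfl
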